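/- Let B^H be a fractional Brownian motion with Hurst parameter H ∈ (1/2, 1). There is a constant C depending only on H such that for all 0 < s ≤ t ≤ 1, P(B^H_s · B^H_t ≤ 0) ≤ C (t-s)^H t^{-H}. -/

import Mathlib

open MeasureTheory ProbabilityTheory Real

/-- Covariance function of fractional Brownian motion with Hurst parameter `H`. -/
noncomputable def fbmCov (H s t : ℝ) : ℝ :=
  (s ^ (2 * H) + t ^ (2 * H) - |s - t| ^ (2 * H)) / 2

/-- `B` is a fractional Brownian motion with Hurst parameter `H` under `P`. -/
def IsFBM {Ω : Type*} [MeasurableSpace Ω] (H : ℝ) (P : Measure Ω)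
    (B : ℝ → Ω → ℝ) : Prop :=
  (∀ t, Measurable (B t)) ∧
  ∀ (n : ℕ) (t : Fin n → ℝ) (a : Fin n → ℝ), (∀ i, 0 ≤ t i) →
    P.map (fun ω => ∑ i, a i * B (t i) ω) =
      gaussianReal 0 (∑ i, ∑ j, a i * a j * fbmCov H (t i) (t j)).toNNReal

open scoped NNReal ENNReal

lemma fbm_aux_prod {Ω : Type*} [MeasurableSpace Ω] (P : Measure Ω)
    [IsProbabilityMeasure P] (X Z : Ω → ℝ) (hX : Measurable X) (hZ : Measurable Z)
    (v w : ℝ≥0)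
    (h : ∀ a b : ℝ, P.map (fun ω => a * X ω + b * Z ω) =
      gaussianReal 0 (a ^ 2 * v + b ^ 2 * w).toNNReal) :
    P.map (fun ω => (X ω, Z ω)) = (gaussianReal 0 v).prod (gaussianReal 0 w) := by
  have : IsProbabilityMeasure (P.map (fun ω => (X ω, Z ω))) :=
    Measure.isProbabilityMeasure_map (by fun_prop)
  apply Measure.ext_of_charFunDual
  ext L
  rw [charFunDual_prod, charFunDual_eq_charFun_map_one, charFunDual_eq_charFun_map_one,
    charFunDual_eq_charFun_map_one, Measure.map_map (by fun_prop) (by fun_prop),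
    gaussianReal_map_continuousLinearMap, gaussianReal_map_continuousLinearMap]
  have e : (⇑L ∘ fun ω => (X ω, Z ω)) = fun ω => L (1, 0) * X ω + L (0, 1) * Z ω := by
    ext ω
    have : (X ω, Z ω) = X ω • ((1 : ℝ), (0 : ℝ)) + Z ω • ((0 : ℝ), (1 : ℝ)) := by simp
    simp only [Function.comp]
    rw [this, map_add, map_smul, map_smul]
    simp [mul_comm]
  rw [e, h, charFun_gaussianReal, charFun_gaussianReal, charFun_gaussianReal, ← Complex.exp_add]
  have h0 : ((L (1, 0) ^ 2 * v + L (0, 1) ^ 2 * w).toNNReal : ℝ)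
      = L (1, 0) ^ 2 * v + L (0, 1) ^ 2 * w := Real.coe_toNNReal _ (by positivity)
  congr 1
  rw [show (((L (1, 0) ^ 2 * v + L (0, 1) ^ 2 * w).toNNReal : ℝ≥0) : ℂ)
    = ((((L (1, 0) ^ 2 * v + L (0, 1) ^ 2 * w).toNNReal : ℝ≥0) : ℝ) : ℂ) from rfl, h0]
  have h1 : (((L.comp (ContinuousLinearMap.inl ℝ ℝ ℝ)) 1 ^ 2).toNNReal : ℝ) = L (1, 0) ^ 2 := by
    rw [Real.coe_toNNReal _ (by positivity)]; simp
  have h2 : (((L.comp (ContinuousLinearMap.inr ℝ ℝ ℝ)) 1 ^ 2).toNNReal : ℝ) = L (0, 1) ^ 2 := by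
    rw [Real.coe_toNNReal _ (by positivity)]; simp
  rw [show ∀ x y : ℝ≥0, ((x * y : ℝ≥0) : ℂ) = (((x : ℝ) * (y : ℝ) : ℝ) : ℂ) from
    fun x y => by push_cast; rfl, show ∀ x y : ℝ≥0, ((x * y : ℝ≥0) : ℂ) = (((x : ℝ) * (y : ℝ) : ℝ) : ℂ) from
    fun x y => by push_cast; rfl, h1, h2]
  have h00 : L (0, 0) = 0 := map_zero L
  simp [h00]
  ring

lemma fbm_aux_small (v : ℝ≥0) (hv : v ≠ 0) (a : ℝ) :
    gaussianReal 0 v {x | |x| ≤ a} ≤ ENNReal.ofReal (2 / √v) * ENNReal.ofReal a := by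
  rw [gaussianReal_apply _ hv]
  have hv' : (0 : ℝ) < v := by positivity
  have hset : {x : ℝ | |x| ≤ a} = Set.Icc (-a) a := by ext x; simp [abs_le]
  calc ∫⁻ x in {x | |x| ≤ a}, gaussianPDF 0 v x
      ≤ ∫⁻ x in {x | |x| ≤ a}, ENNReal.ofReal (1 / √v) := by
        apply lintegral_mono
        intro x
        apply ENNReal.ofReal_le_ofReal
        rw [gaussianPDFReal, one_div]
        have h1 : rexp (-(x - 0) ^ 2 / (2 * v)) ≤ 1 := by
          rw [Real.exp_le_one_iff]
          apply div_nonpos_of_nonpos_of_nonneg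
          · nlinarith [sq_nonneg (x - 0)]
          · positivity
        have h2 : (√(2 * π * v))⁻¹ ≤ (√v)⁻¹ := by
          apply inv_anti₀ (by positivity)
          apply Real.sqrt_le_sqrt
          nlinarith [Real.pi_gt_three]
        calc _ ≤ (√(2 * π * v))⁻¹ * 1 := by gcongr
          _ ≤ _ := by simpa using h2
    _ = ENNReal.ofReal (2 / √v) * ENNReal.ofReal a := by
        rw [hset, setLIntegral_const, Real.volume_Icc, ← ENNReal.ofReal_mul (by positivity),
          ← ENNReal.ofReal_mul (by positivity)]
        congr 1; ring

lemma fbm_aux_abs (w : ℝ≥0) :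
    ∫⁻ z, ENNReal.ofReal (|z|) ∂(gaussianReal 0 w) ≤ ENNReal.ofReal (√w) := by
  have hm : MemLp (fun z : ℝ => z) 2 (gaussianReal 0 w) := memLp_id_gaussianReal' 2 (by simp)
  have hm' : MemLp (fun z : ℝ => |z|) 2 (gaussianReal 0 w) := hm.abs
  have hi : Integrable (fun z : ℝ => |z|) (gaussianReal 0 w) := hm'.integrable (by norm_num)
  rw [← ofReal_integral_eq_lintegral_ofReal hi (by filter_upwards with z; positivity)]
  apply ENNReal.ofReal_le_ofReal
  apply Real.le_sqrt_of_sq_le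
  have h1 := variance_nonneg (fun z : ℝ => |z|) (gaussianReal 0 w)
  rw [variance_eq_sub hm'] at h1
  have h2 : Var[fun x ↦ x; gaussianReal 0 w] = w := variance_fun_id_gaussianReal
  rw [variance_eq_sub hm] at h2
  have h3 : ∫ x, x ∂(gaussianReal 0 w) = 0 := integral_id_gaussianReal
  simp [h3] at h1 h2
  linarith

lemma fbm_aux_main {Ω : Type*} [MeasurableSpace Ω] (P : Measure Ω)
    [IsProbabilityMeasure P] (X Z : Ω → ℝ) (hX : Measurable X) (hZ : Measurable Z)
    (v w : ℝ≥0) (hv : v ≠ 0)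
    (h : ∀ a b : ℝ, P.map (fun ω => a * X ω + b * Z ω) =
      gaussianReal 0 (a ^ 2 * v + b ^ 2 * w).toNNReal) :
    P {ω | |X ω| ≤ 2 * |Z ω|} ≤ ENNReal.ofReal (4 * √w / √v) := by
  have hp := fbm_aux_prod P X Z hX hZ v w h
  have hS : MeasurableSet {p : ℝ × ℝ | |p.1| ≤ 2 * |p.2|} :=
    measurableSet_le (by fun_prop) (by fun_prop)
  have : P {ω | |X ω| ≤ 2 * |Z ω|} =
      (P.map (fun ω => (X ω, Z ω))) {p : ℝ × ℝ | |p.1| ≤ 2 * |p.2|} := by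
    rw [Measure.map_apply (by fun_prop) hS]; rfl
  rw [this, hp, Measure.prod_apply_symm hS]
  calc _ ≤ ∫⁻ z, ENNReal.ofReal (2 / √v) * (ENNReal.ofReal 2 * ENNReal.ofReal |z|)
        ∂(gaussianReal 0 w) := by
        apply lintegral_mono
        intro z
        have := fbm_aux_small v hv (2 * |z|)
        rw [ENNReal.ofReal_mul (by norm_num)] at this
        exact this
    _ = ENNReal.ofReal (2 / √v) * (ENNReal.ofReal 2 * ∫⁻ z, ENNReal.ofReal |z|
        ∂(gaussianReal 0 w)) := by
        rw [lintegral_const_mul _ (by fun_prop), lintegral_const_mul _ (by fun_prop)]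
    _ ≤ ENNReal.ofReal (2 / √v) * (ENNReal.ofReal 2 * ENNReal.ofReal (√w)) := by
        gcongr; exact fbm_aux_abs w
    _ = _ := by
        rw [← ENNReal.ofReal_mul (by positivity), ← ENNReal.ofReal_mul (by positivity)]
        congr 1; ring

/-- For fBm with `H ∈ (1/2,1)` there is a constant `C = C(H)` such that
`P(B^H_s B^H_t ≤ 0) ≤ C (t-s)^H t^{-H}` for all `0 < s ≤ t ≤ 1`. -/
theorem fbm_prob_sign_change {Ω : Type*} [MeasurableSpace Ω] (P : Measure Ω)
    [IsProbabilityMeasure P] (H : ℝ) (hH : H ∈ Set.Ioo (1 / 2 : ℝ) 1)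
    (B : ℝ → Ω → ℝ) (hB : IsFBM H P B) :
    ∃ C : ℝ, 0 < C ∧ ∀ s t : ℝ, 0 < s → s ≤ t → t ≤ 1 →
      P {ω | B s ω * B t ω ≤ 0} ≤
        ENNReal.ofReal (C * (t - s) ^ H * t ^ (-H)) := by
  obtain ⟨hH1, hH2⟩ := hH
  obtain ⟨hBm, hBg⟩ := hB
  refine ⟨4, by norm_num, fun s t hs hst _ => ?_⟩
  have ht : 0 < t := hs.trans_le hst
  have hH0 : 0 ≤ H := by linarith
  have hmul : ∀ x : ℝ, 0 ≤ x → x ^ (2 * H) = (x ^ H) ^ 2 := fun x hx => by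
    rw [mul_comm, Real.rpow_mul hx]; norm_num
  have hT : 0 < t ^ H := by positivity
  have hS : 0 < s ^ H := by positivity
  have hD : 0 ≤ (t - s) ^ H := Real.rpow_nonneg (by linarith) _
  have hrhs : 4 * (t - s) ^ H * t ^ (-H) = 4 * (t - s) ^ H / t ^ H := by
    rw [Real.rpow_neg ht.le]; rfl
  rw [hrhs]
  have hsub : t ^ H ≤ s ^ H + (t - s) ^ H := by
    have := Real.rpow_add_le_add_rpow hs.le (sub_nonneg.2 hst) hH0 hH2.le
    simpa using this
  by_cases hcase : t - s ≤ s
  swap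
  · -- trivial case
    have h1 : s ^ H ≤ (t - s) ^ H := Real.rpow_le_rpow hs.le (by linarith) hH0
    refine prob_le_one.trans ?_
    rw [← ENNReal.ofReal_one]
    apply ENNReal.ofReal_le_ofReal
    rw [le_div_iff₀ hT]
    linarith
  have h1 : (t - s) ^ H ≤ s ^ H := Real.rpow_le_rpow (by linarith) hcase hH0
  have hST : s ^ H ≤ t ^ H := Real.rpow_le_rpow hs.le hst hH0
  have hbs : fbmCov H s s = (s ^ H) ^ 2 := by
    simp only [fbmCov, sub_self, abs_zero]
    rw [Real.zero_rpow (by linarith), hmul s hs.le]; ring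
  have hbt : fbmCov H t t = (t ^ H) ^ 2 := by
    simp only [fbmCov, sub_self, abs_zero]
    rw [Real.zero_rpow (by linarith), hmul t ht.le]; ring
  have hc : fbmCov H s t = ((s ^ H) ^ 2 + (t ^ H) ^ 2 - ((t - s) ^ H) ^ 2) / 2 := by
    simp only [fbmCov]
    rw [abs_sub_comm, abs_of_nonneg (sub_nonneg.2 hst), hmul _ hs.le, hmul _ ht.le,
      hmul _ (sub_nonneg.2 hst)]
  have hc' : fbmCov H t s = fbmCov H s t := by
    simp only [fbmCov]; rw [abs_sub_comm]; ring
  have hlin : ∀ a b : ℝ, P.map (fun ω => a * B t ω + b * B s ω) =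
      gaussianReal 0 (a ^ 2 * (t ^ H) ^ 2 + 2 * a * b * fbmCov H s t
        + b ^ 2 * (s ^ H) ^ 2).toNNReal := by
    intro a b
    have := hBg 2 ![t, s] ![a, b] (by intro i; fin_cases i <;> simp [hs.le, ht.le])
    simp only [Fin.sum_univ_two, Matrix.cons_val_zero, Matrix.cons_val_one, hbs, hbt, hc'] at this
    rw [this]
    congr 2; ring
  generalize hceq : fbmCov H s t = c at *
  generalize t ^ H = T at *
  generalize s ^ H = S at *
  generalize (t - s) ^ H = D at *
  have hc0 : T ^ 2 / 2 ≤ c := by rw [hc]; nlinarith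
  have hcST : c ≤ S * T := by rw [hc]; nlinarith
  have hcpos : 0 < c := lt_of_lt_of_le (by positivity) hc0
  have hw0 : 0 ≤ S ^ 2 - c ^ 2 / T ^ 2 := by
    rw [sub_nonneg, div_le_iff₀ (by positivity), ← mul_pow]
    exact pow_le_pow_left₀ hcpos.le hcST 2
  have hwD : S ^ 2 - c ^ 2 / T ^ 2 ≤ D ^ 2 := by
    have e : D ^ 2 - (S ^ 2 - c ^ 2 / T ^ 2) = (T ^ 2 - c) ^ 2 / T ^ 2 := by
      field_simp; rw [hc]; ring
    have : 0 ≤ (T ^ 2 - c) ^ 2 / T ^ 2 := by positivity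
    linarith
  have hv0 : (T ^ 2).toNNReal ≠ 0 := by
    have : 0 < (T ^ 2).toNNReal := Real.toNNReal_pos.2 (by positivity)
    exact this.ne'
  have key := fbm_aux_main P (B t) (fun ω => B s ω - c / T ^ 2 * B t ω) (hBm t)
    ((hBm s).sub ((hBm t).const_mul _)) (T ^ 2).toNNReal (S ^ 2 - c ^ 2 / T ^ 2).toNNReal hv0 (by
      intro a b
      have := hlin (a - b * (c / T ^ 2)) b
      rw [Real.coe_toNNReal _ (by positivity), Real.coe_toNNReal _ hw0]
      convert this using 2
      · ext ω; ring
      · congr 1; field_simp; ring)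
  rw [Real.coe_toNNReal (T ^ 2) (by positivity), Real.coe_toNNReal _ hw0,
    Real.sqrt_sq hT.le] at key
  refine (measure_mono ?_).trans (key.trans ?_)
  · intro ω hω
    simp only [Set.mem_setOf_eq] at hω ⊢
    generalize B s ω = y at *
    generalize B t ω = x at *
    have hr : 1 / 2 ≤ c / T ^ 2 := by rw [le_div_iff₀ (by positivity)]; linarith
    generalize c / T ^ 2 = r at *
    have : |r * x| ≤ |y - r * x| := by
      apply sq_le_sq.1
      nlinarith [sq_nonneg y]
    rw [abs_mul, abs_of_pos (by linarith)] at this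
    nlinarith [abs_nonneg x]
  · apply ENNReal.ofReal_le_ofReal
    gcongr
    exact Real.sqrt_le_iff.2 ⟨hD, hwD⟩
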